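/- Let X be a topological space, x ∈ X, and let n ≥ 0 and k ≥ 1 be natural numbers. Let C(Sⁿ, X) denote the space of continuous maps from the unit sphere Sⁿ in ℝ^{n+1} to X, equipped with the compact-open topology, and let const_x ∈ C(Sⁿ, X) denote the constant map at x. Then there exist an action φ of π_k(X, x) on π_{n+k}(X, x) by group automorphisms and a group isomorphism from π_k(C(Sⁿ, X), const_x) to the semidirect product π_{n+k}(X, x) ⋊_φ π_k(X, x). -/

import Mathlib

open Topology
open scoped unitInterval Topology.Homotopy

section HomotopyGroupMaps

variable {N N' X Y : Type*} [TopologicalSpace X] [TopologicalSpace Y] {x : X} {y : Y}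

namespace GenLoop

theorem homotopic_iff {p q : Ω^ N X x} :
    Homotopic p q ↔ ∃ H : C(I × (I^N), X), (∀ u, H (0, u) = p u) ∧ (∀ u, H (1, u) = q u) ∧
      ∀ s, ∀ u ∈ Cube.boundary N, H (s, u) = x := by
  constructor
  · rintro ⟨H⟩
    exact ⟨H.toContinuousMap, H.apply_zero, H.apply_one,
      fun s u hu ↦ (H.eq_fst s hu).trans (p.2 u hu)⟩
  · rintro ⟨H, h0, h1, hb⟩
    exact ⟨⟨⟨H, h0, h1⟩, fun s u hu ↦ (hb s u hu).trans (p.2 u hu).symm⟩⟩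

theorem Homotopic.map_of_continuous {φ : Ω^ N X x → Ω^ N' Y y} (hφ : Continuous φ)
    {p q : Ω^ N X x} (h : Homotopic p q) : Homotopic (φ p) (φ q) := by
  obtain ⟨H, h0, h1, hb⟩ := homotopic_iff.1 h
  let P : I → Ω^ N X x := fun s ↦ ⟨H.curry s, hb s⟩
  have hP : Continuous P := H.curry.continuous.subtype_mk _
  have hP0 : P 0 = p := GenLoop.ext _ _ h0
  have hP1 : P 1 = q := GenLoop.ext _ _ h1
  refine homotopic_iff.2 ⟨⟨fun z ↦ φ (P z.1) z.2, ?_⟩, fun u ↦ ?_, fun u ↦ ?_,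
    fun s u hu ↦ (φ (P s)).2 u hu⟩
  · exact ((hφ.comp hP).comp continuous_fst).eval continuous_snd
  · simp [hP0]
  · simp [hP1]

/-- Postcomposition of generalized loops with a pointed continuous map. -/
def map (f : C(X, Y)) (hf : f x = y) (p : Ω^ N X x) : Ω^ N Y y :=
  ⟨f.comp p.1, fun u hu ↦ (congrArg f (p.2 u hu)).trans hf⟩

@[simp]
theorem map_apply (f : C(X, Y)) (hf : f x = y) (p : Ω^ N X x) (u : I^N) :
    map f hf p u = f (p u) := rfl

theorem continuous_map (f : C(X, Y)) (hf : f x = y) : Continuous (map (N := N) f hf) :=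
  (f.continuous_postcomp.comp continuous_subtype_val).subtype_mk _

theorem transAt_apply [DecidableEq N] (i : N) (p q : Ω^ N X x) (t : I^N) :
    transAt i p q t = if (t i : ℝ) ≤ 1 / 2
      then p (Function.update t i <| Set.projIcc 0 1 zero_le_one (2 * t i))
      else q (Function.update t i <| Set.projIcc 0 1 zero_le_one (2 * t i - 1)) := rfl

theorem map_transAt [DecidableEq N] (f : C(X, Y)) (hf : f x = y) (i : N) (p q : Ω^ N X x) :
    map f hf (transAt i p q) = transAt i (map f hf p) (map f hf q) := by
  ext t
  simp only [map_apply, transAt_apply]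
  split_ifs <;> rfl

end GenLoop

namespace HomotopyGroup

open GenLoop

theorem mk_eq_mk_iff {p q : Ω^ N X x} :
    (⟦p⟧ : HomotopyGroup N X x) = ⟦q⟧ ↔ Homotopic p q := Quotient.eq

variable [DecidableEq N] [DecidableEq N'] [Nonempty N] [Nonempty N']

/-- A continuous map between spaces of generalized loops which respects concatenation
induces a homomorphism of homotopy groups. -/
noncomputable def homOfContinuous (φ : Ω^ N X x → Ω^ N' Y y) (hφ : Continuous φ) (i : N) (i' : N')
    (h : ∀ p q, φ (transAt i p q) = transAt i' (φ p) (φ q)) :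
    HomotopyGroup N X x →* HomotopyGroup N' Y y :=
  MonoidHom.mk' (Quotient.map φ fun _ _ hpq ↦ hpq.map_of_continuous hφ) fun a b ↦
    Quotient.inductionOn₂ a b fun p q ↦ by
      refine (congrArg (Quotient.map φ _) (mul_spec (i := i) (p := p) (q := q))).trans ?_
      refine Eq.trans ?_ (mul_spec (i := i') (p := φ p) (q := φ q)).symm
      rw [← h]
      rfl

/-- A homeomorphism between spaces of generalized loops which respects concatenation
induces an isomorphism of homotopy groups. -/
noncomputable def equivOfHomeomorph (φ : Ω^ N X x ≃ₜ Ω^ N' Y y) (i : N) (i' : N')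
    (h : ∀ p q, φ (transAt i p q) = transAt i' (φ p) (φ q)) :
    HomotopyGroup N X x ≃* HomotopyGroup N' Y y :=
  MonoidHom.toMulEquiv (homOfContinuous φ φ.continuous i i' h)
    (homOfContinuous φ.symm φ.symm.continuous i' i fun p q ↦ by
      rw [φ.symm_apply_eq, h, φ.apply_symm_apply, φ.apply_symm_apply])
    (MonoidHom.ext fun a ↦ Quotient.inductionOn a fun p ↦
      congrArg (Quotient.mk _) (φ.symm_apply_apply p))
    (MonoidHom.ext fun a ↦ Quotient.inductionOn a fun p ↦
      congrArg (Quotient.mk _) (φ.apply_symm_apply p))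

/-- The homomorphism of homotopy groups induced by a pointed continuous map. -/
noncomputable def map (f : C(X, Y)) (hf : f x = y) : HomotopyGroup N X x →* HomotopyGroup N Y y :=
  homOfContinuous (GenLoop.map f hf) (GenLoop.continuous_map f hf) (Classical.arbitrary N)
    (Classical.arbitrary N) (GenLoop.map_transAt f hf _)

/-- A pointed homeomorphism induces an isomorphism of homotopy groups. -/
noncomputable def congr (e : X ≃ₜ Y) (he : e x = y) : HomotopyGroup N X x ≃* HomotopyGroup N Y y :=
  MonoidHom.toMulEquiv (map e he) (map e.symm (e.symm_apply_eq.2 he.symm))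
    (MonoidHom.ext fun a ↦ Quotient.inductionOn a fun p ↦
      congrArg (Quotient.mk _) (GenLoop.ext _ _ fun u ↦ e.symm_apply_apply (p u)))
    (MonoidHom.ext fun a ↦ Quotient.inductionOn a fun p ↦
      congrArg (Quotient.mk _) (GenLoop.ext _ _ fun u ↦ e.apply_symm_apply (p u)))

/-- Homotopy groups only depend on the cardinality of the index type. -/
noncomputable def reindex (e : N ≃ N') : HomotopyGroup N X x ≃* HomotopyGroup N' X x :=
  equivOfHomeomorph (GenLoop.congr x e) (Classical.arbitrary N) (e (Classical.arbitrary N))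
    fun p q ↦ by
      ext t
      have key (c : I) : (fun m ↦ Function.update t (e (Classical.arbitrary N)) c (e m)) =
          Function.update (fun m ↦ t (e m)) (Classical.arbitrary N) c :=
        Function.update_comp_eq_of_injective t e.injective _ c
      change transAt _ p q (fun m ↦ t (e m)) = _
      simp only [transAt_apply, ← key]
      rfl

/-- The homotopy groups of an iterated loop space are homotopy groups of the original space. -/
noncomputable def iteratedLoop {M : Type*} [DecidableEq M] :
    HomotopyGroup N (Ω^ M X x) const ≃* HomotopyGroup (N ⊕ M) X x :=
  equivOfHomeomorph (GenLoop.genLoopGenLoopEquiv x) (Classical.arbitrary N)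
    (Sum.inl (Classical.arbitrary N)) fun p q ↦ by
      ext t
      have key (c : I) : (Function.update t (Sum.inl (Classical.arbitrary N)) c) ∘ Sum.inl =
          Function.update (t ∘ Sum.inl) (Classical.arbitrary N) c :=
        Function.update_comp_eq_of_injective t Sum.inl_injective _ c
      have key' (c : I) : (Function.update t (Sum.inl (Classical.arbitrary N)) c) ∘
          (Sum.inr : M → N ⊕ M) = t ∘ Sum.inr := by
        ext; simp
      change transAt _ p q (t ∘ Sum.inl) (t ∘ Sum.inr) = _
      have hval (r : Ω^ N (Ω^ M X x) const) (t : I^(N ⊕ M)) :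
          GenLoop.genLoopGenLoopEquiv x r t = r (t ∘ Sum.inl) (t ∘ Sum.inr) := rfl
      simp only [transAt_apply, hval, key, key', Function.comp_apply]
      split_ifs <;> rfl

end HomotopyGroup

end HomotopyGroupMaps

section Fibration

open GenLoop

/-- A homotopy lifting property, relative to the points whose data are constant at the
base point. -/
def HasPointedLifting {E B : Type*} [TopologicalSpace E] [TopologicalSpace B] (ev : C(E, B))
    (e₀ : E) (b₀ : B) : Prop :=
  ∀ (T : Type) [TopologicalSpace T] (f : C(T, E)) (a : C(I × T, B)), (∀ t, a (0, t) = ev (f t)) →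
    ∃ L : C(I × T, E), (∀ t, L (0, t) = f t) ∧ (∀ z, ev (L z) = a z) ∧
      ∀ t, f t = e₀ → (∀ s, a (s, t) = b₀) → ∀ s, L (s, t) = e₀

variable {N : Type} {E B : Type*} [TopologicalSpace E] [TopologicalSpace B] {ev : C(E, B)}
  {e₀ : E} {b₀ : B}

/-- The inclusion of the fibre of `ev` over `b₀`. -/
def fibreInclusion (ev : C(E, B)) (b₀ : B) : C({e // ev e = b₀}, E) :=
  ⟨Subtype.val, continuous_subtype_val⟩

/-- A generalized loop in the total space whose projection is null-homotopic deforms into the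
fibre. -/
theorem HasPointedLifting.exists_homotopic_fibre (hlift : HasPointedLifting ev e₀ b₀)
    (he : ev e₀ = b₀) (f : Ω^ N E e₀) (hf : Homotopic (GenLoop.map ev he f) const) :
    ∃ g : Ω^ N {e // ev e = b₀} ⟨e₀, he⟩,
      Homotopic (GenLoop.map (fibreInclusion ev b₀) rfl g) f := by
  obtain ⟨a, ha0, ha1, hab⟩ := homotopic_iff.1 hf
  obtain ⟨L, hL0, hL, hLc⟩ := hlift (I^N) f.1 a ha0
  have hLb (s) (u) (hu : u ∈ Cube.boundary N) : L (s, u) = e₀ :=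
    hLc u (f.2 u hu) (fun s ↦ hab s u hu) s
  refine ⟨⟨⟨fun u ↦ ⟨L (1, u), (hL _).trans (ha1 u)⟩, Continuous.subtype_mk (by fun_prop) _⟩,
    fun u hu ↦ Subtype.ext (hLb 1 u hu)⟩,
    Homotopic.symm (homotopic_iff.2 ⟨L, hL0, fun u ↦ rfl, hLb⟩)⟩

/-- If the projection has a section, then a generalized loop in the fibre which is null-homotopic
in the total space is null-homotopic in the fibre. -/
theorem HasPointedLifting.homotopic_const_fibre (hlift : HasPointedLifting ev e₀ b₀)
    (he : ev e₀ = b₀) (sec : C(B, E)) (hsec₀ : sec b₀ = e₀) (hsec : ∀ b, ev (sec b) = b)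
    (g : Ω^ N {e // ev e = b₀} ⟨e₀, he⟩)
    (hg : Homotopic (GenLoop.map (fibreInclusion ev b₀) rfl g) (const : Ω^ N E e₀)) :
    Homotopic g const := by
  obtain ⟨H, hH0, hH1, hHb⟩ := homotopic_iff.1 hg
  replace hHb : ∀ s, ∀ u ∈ Cube.boundary N, H (s, u) = e₀ := hHb
  have hH0' (t : I^N) : ev (H (0, t)) = b₀ := by
    rw [hH0]
    exact (g t).2
  let K : C(I × (I^N), E) := ⟨fun z ↦ if (z.1 : ℝ) ≤ 1 / 2
      then H (Set.projIcc 0 1 zero_le_one (2 * z.1), z.2)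
      else sec (ev (H (Set.projIcc 0 1 zero_le_one (2 - 2 * z.1), z.2))), by
    refine Continuous.if_le ?_ ?_ (by fun_prop) continuous_const fun z hz ↦ ?_
    · fun_prop
    · fun_prop
    · rw [hz, show (2 * (1 / 2) : ℝ) = 1 by norm_num, show (2 - 1 : ℝ) = 1 by norm_num,
        Set.projIcc_right]
      exact (hH1 _).trans ((congrArg (fun e ↦ sec (ev e)) (hH1 _)).trans
        ((congrArg sec he).trans hsec₀)).symm⟩
  let a : C(I × (I × (I^N)), B) := ⟨fun z ↦ ev (H (Set.projIcc 0 1 zero_le_one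
    ((1 - (z.1 : ℝ)) * min (2 * (z.2.1 : ℝ)) (2 - 2 * (z.2.1 : ℝ))), z.2.2)), by fun_prop⟩
  have hK0 (t : I^N) : K (0, t) = H (0, t) := by simp [K]
  have hK1 (t : I^N) : K (1, t) = e₀ := by
    have : ¬ (1 : ℝ) ≤ 2⁻¹ := by norm_num
    simp [K, hH0', hsec₀, this]
  have hKb (τ : I) (t : I^N) (ht : t ∈ Cube.boundary N) : K (τ, t) = e₀ := by
    simp [K, hHb _ t ht, he, hsec₀]
  have haK (z : I × (I^N)) : a (0, z) = ev (K z) := by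
    obtain ⟨τ, t⟩ := z
    by_cases h : (τ : ℝ) ≤ 1 / 2
    · have hmin : min (2 * (τ : ℝ)) (2 - 2 * τ) = 2 * τ := min_eq_left (by linarith)
      simp only [a, K, ContinuousMap.coe_mk, if_pos h, hmin]
      simp
    · have hmin : min (2 * (τ : ℝ)) (2 - 2 * τ) = 2 - 2 * τ := min_eq_right (by linarith)
      simp only [a, K, ContinuousMap.coe_mk, if_neg h, hmin, hsec]
      simp
  have ha1 (z : I × (I^N)) : a (1, z) = b₀ := by simp [a, hH0']
  have ha_left (s : I) (t : I^N) : a (s, (0, t)) = b₀ := by simp [a, hH0']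
  have ha_right (s : I) (t : I^N) : a (s, (1, t)) = b₀ := by simp [a, hH0']
  have hab (s τ : I) (t : I^N) (ht : t ∈ Cube.boundary N) : a (s, (τ, t)) = b₀ := by
    simp [a, hHb _ t ht, he]
  obtain ⟨L, hL0, hL, hLc⟩ := hlift (I × (I^N)) K a haK
  have hLb (s τ : I) (t : I^N) (ht : t ∈ Cube.boundary N) : L (s, (τ, t)) = e₀ :=
    hLc (τ, t) (hKb τ t ht) (fun s ↦ hab s τ t ht) s
  let g₁ : Ω^ N {e // ev e = b₀} ⟨e₀, he⟩ :=
    ⟨⟨fun t ↦ ⟨L (1, (0, t)), (hL _).trans (ha1 _)⟩, Continuous.subtype_mk (by fun_prop) _⟩,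
      fun t ht ↦ Subtype.ext (hLb 1 0 t ht)⟩
  have h₁ : Homotopic g g₁ := homotopic_iff.2
    ⟨⟨fun z ↦ ⟨L (z.1, (0, z.2)), (hL _).trans (ha_left _ _)⟩,
      Continuous.subtype_mk (by fun_prop) _⟩,
      fun t ↦ Subtype.ext ((hL0 _).trans ((hK0 t).trans (hH0 t))), fun t ↦ rfl,
      fun s t ht ↦ Subtype.ext (hLb s 0 t ht)⟩
  have h₂ : Homotopic g₁ const := homotopic_iff.2
    ⟨⟨fun z ↦ ⟨L (1, z), (hL _).trans (ha1 _)⟩, Continuous.subtype_mk (by fun_prop) _⟩,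
      fun t ↦ rfl,
      fun t ↦ Subtype.ext (hLc (1, t) (hK1 t) (fun s ↦ ha_right s t) 1),
      fun s t ht ↦ Subtype.ext (hLb 1 s t ht)⟩
  exact h₁.trans h₂

/-- The homotopy groups of the total space of a fibration with a section are semidirect products
of those of the fibre and those of the base. -/
theorem HasPointedLifting.exists_mulEquiv_semidirectProduct [DecidableEq N] [Nonempty N]
    (hlift : HasPointedLifting ev e₀ b₀) (he : ev e₀ = b₀) (sec : C(B, E)) (hsec₀ : sec b₀ = e₀)
    (hsec : ∀ b, ev (sec b) = b) {A : Type*} [Group A]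
    (α : A ≃* HomotopyGroup N {e // ev e = b₀} ⟨e₀, he⟩) :
    ∃ φ : HomotopyGroup N B b₀ →* MulAut A,
      Nonempty (HomotopyGroup N E e₀ ≃* A ⋊[φ] HomotopyGroup N B b₀) := by
  let ι : HomotopyGroup N {e // ev e = b₀} ⟨e₀, he⟩ →* HomotopyGroup N E e₀ :=
    HomotopyGroup.map (fibreInclusion ev b₀) rfl
  let π : HomotopyGroup N E e₀ →* HomotopyGroup N B b₀ := HomotopyGroup.map ev he
  let s : HomotopyGroup N B b₀ →* HomotopyGroup N E e₀ := HomotopyGroup.map sec hsec₀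
  have hs : Function.RightInverse s π := fun b ↦ Quotient.inductionOn b fun p ↦
    congrArg (Quotient.mk _) (GenLoop.ext _ _ fun u ↦ hsec (p u))
  have hι : Function.Injective ι := by
    refine (injective_iff_map_eq_one ι).2 fun c ↦ Quotient.inductionOn c fun g hg ↦ ?_
    exact HomotopyGroup.mk_eq_mk_iff.2 (hlift.homotopic_const_fibre he sec hsec₀ hsec g
      (HomotopyGroup.mk_eq_mk_iff.1 hg))
  have hexact : ι.range = π.ker := by
    apply le_antisymm
    · rintro _ ⟨c, rfl⟩
      refine Quotient.inductionOn c fun g ↦ ?_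
      exact congrArg (Quotient.mk _) (GenLoop.ext _ _ fun u ↦ (g u).2)
    · intro c
      refine Quotient.inductionOn c fun f hf ↦ ?_
      obtain ⟨g, hg⟩ := hlift.exists_homotopic_fibre he f (HomotopyGroup.mk_eq_mk_iff.1 hf)
      exact ⟨(⟦g⟧ : HomotopyGroup N _ _), HomotopyGroup.mk_eq_mk_iff.2 hg⟩
  let S : GroupExtension A (HomotopyGroup N E e₀) (HomotopyGroup N B b₀) :=
    { inl := ι.comp α.toMonoidHom
      rightHom := π
      inl_injective := hι.comp α.injective
      range_inl_eq_ker_rightHom := by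
        rw [← hexact, MonoidHom.range_comp, MonoidHom.range_eq_top.2 α.surjective,
          ← MonoidHom.range_eq_map]
      rightHom_surjective := hs.surjective }
  let t : S.Splitting := ⟨s, hs⟩
  exact ⟨t.conjAct, ⟨t.semidirectProductMulEquiv.symm⟩⟩

end Fibration

section Collapse

open Set

/-- A continuous map from a cube to a pointed space `(S, p)` which collapses the boundary to `p`
and is a bijection from the interior onto the complement of `p`. -/
structure CubeCollapse (N S : Type*) [TopologicalSpace S] where
  /-- The collapse map. -/
  toMap : C(I^N, S)
  /-- The image of the boundary. -/
  pt : S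
  map_eq_pt_iff (u : I^N) : toMap u = pt ↔ u ∈ Cube.boundary N
  injOn_interior (u v : I^N) : u ∉ Cube.boundary N → toMap u = toMap v → u = v
  exists_map_eq (y : S) : y ≠ pt → ∃ u, toMap u = y

/-- The map from a compact Hausdorff space to the one-point compactification of an open subset
which collapses the complement is continuous. -/
theorem OnePoint.continuous_collapse {K : Type*} [TopologicalSpace K] [T2Space K]
    {U : Set K} (hU : IsOpen U) [DecidablePred (· ∈ U)] :
    Continuous (fun u ↦ if h : u ∈ U then ((⟨u, h⟩ : U) : OnePoint U) else OnePoint.infty) := by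
  rw [continuous_def]
  intro s hs
  by_cases hmem : OnePoint.infty ∈ s
  · obtain ⟨-, hc⟩ := (OnePoint.isOpen_iff_of_mem hmem).1 hs
    convert (hc.image continuous_subtype_val).isClosed.isOpen_compl using 1
    ext u
    by_cases h : u ∈ U <;> simp [h, hmem]
  · convert hU.isOpenMap_subtype_val _ ((OnePoint.isOpen_iff_of_notMem hmem).1 hs) using 1
    ext u
    by_cases h : u ∈ U <;> simp [h, hmem]

theorem Cube.isOpen_compl_boundary {N : Type*} [Finite N] : IsOpen (Cube.boundary N)ᶜ := by
  have : Cube.boundary N = ⋃ i, {y : I^N | y i = 0 ∨ y i = 1} := by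
    ext; simp [Cube.boundary]
  rw [this, isOpen_compl_iff]
  refine isClosed_iUnion_of_finite fun i ↦ ?_
  exact (isClosed_eq (continuous_apply i) continuous_const).union
    (isClosed_eq (continuous_apply i) continuous_const)

theorem Cube.notMem_boundary_iff {N : Type*} [Fintype N] {u : I^N} :
    u ∉ Cube.boundary N ↔ ‖fun i ↦ 2 * (u i : ℝ) - 1‖ < 1 := by
  rw [pi_norm_lt_iff one_pos]
  simp only [Cube.boundary, mem_ofPred_eq, not_exists, not_or, Real.norm_eq_abs, abs_lt]
  refine forall_congr' fun i ↦ ?_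
  rw [← Ne, ← Ne, ← unitInterval.pos_iff_ne_zero, ← unitInterval.lt_one_iff_ne_one,
    ← unitInterval.coe_pos, ← unitInterval.coe_lt_one]
  constructor <;> rintro ⟨h, h'⟩ <;> constructor <;> linarith

theorem Cube.mem_boundary_iff {N : Type*} [Fintype N] {u : I^N} :
    u ∈ Cube.boundary N ↔ 1 ≤ ‖fun i ↦ 2 * (u i : ℝ) - 1‖ := by
  rw [← not_lt, ← Cube.notMem_boundary_iff, not_not]

theorem Cube.norm_le_one {N : Type*} [Fintype N] (u : I^N) :
    ‖fun i ↦ 2 * (u i : ℝ) - 1‖ ≤ 1 := by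
  rw [pi_norm_le_iff_of_nonneg zero_le_one]
  intro i
  rw [Real.norm_eq_abs, abs_le]
  constructor <;> linarith [(u i).2.1, (u i).2.2]

/-- The interior of a cube is homeomorphic to the unit ball of the supremum norm. -/
noncomputable def Cube.interiorHomeomorphBall (N : Type*) [Fintype N] :
    ((Cube.boundary N)ᶜ : Set (I^N)) ≃ₜ Metric.ball (0 : N → ℝ) 1 where
  toFun u := ⟨fun i ↦ 2 * (u.1 i : ℝ) - 1, mem_ball_zero_iff.2 (Cube.notMem_boundary_iff.1 u.2)⟩
  invFun v := by
    refine ⟨fun i ↦ ⟨(v.1 i + 1) / 2, ?_⟩, ?_⟩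
    · have h := (norm_le_pi_norm v.1 i).trans (mem_ball_zero_iff.1 v.2).le
      rw [Real.norm_eq_abs, abs_le] at h
      constructor <;> linarith
    · refine Cube.notMem_boundary_iff.2 (lt_of_eq_of_lt ?_ (mem_ball_zero_iff.1 v.2))
      congr 1
      ext i
      simp only
      ring
  left_inv u := by ext i; simp
  right_inv v := by ext i; simp only; ring
  continuous_toFun := by
    refine Continuous.subtype_mk (continuous_pi fun i ↦ ?_) _
    exact (continuous_const.mul (continuous_subtype_val.comp
      ((continuous_apply i).comp continuous_subtype_val))).sub continuous_const
  continuous_invFun := by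
    refine Continuous.subtype_mk (continuous_pi fun i ↦ Continuous.subtype_mk ?_ _) _
    exact (((continuous_apply i).comp continuous_subtype_val).add continuous_const).div_const 2

theorem nonempty_cubeCollapse_sphere (n : ℕ) :
    Nonempty (CubeCollapse (Fin n) (Metric.sphere (0 : EuclideanSpace ℝ (Fin (n + 1))) 1)) := by
  classical
  let U : Set (I^(Fin n)) := (Cube.boundary (Fin n))ᶜ
  let e : OnePoint U ≃ₜ Metric.sphere (0 : EuclideanSpace ℝ (Fin (n + 1))) 1 :=
    ((Cube.interiorHomeomorphBall (Fin n)).trans Homeomorph.unitBall.symm).onePointCongr.trans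
      (onePointEquivSphereOfFinrankEq (by simp))
  refine ⟨⟨⟨_, e.continuous.comp (OnePoint.continuous_collapse Cube.isOpen_compl_boundary)⟩,
    e OnePoint.infty, fun u ↦ ?_, fun u v hu huv ↦ ?_, fun y hy ↦ ?_⟩⟩
  · by_cases h : u ∈ Cube.boundary (Fin n) <;> simp [h]
  · by_cases h : v ∈ Cube.boundary (Fin n)
    · simp [h, hu] at huv
    · simpa [h, hu] using huv
  · obtain ⟨z, rfl⟩ := e.surjective y
    have hz : z ≠ OnePoint.infty := fun h ↦ hy (h ▸ rfl)
    obtain ⟨u, rfl⟩ := OnePoint.ne_infty_iff_exists.1 hz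
    refine ⟨u.1, ?_⟩
    have hu : u.1 ∉ Cube.boundary (Fin n) := u.2
    simp [hu]

namespace CubeCollapse

variable {N S X T : Type*} [TopologicalSpace S] [TopologicalSpace X] [TopologicalSpace T]

theorem exists_descend [T2Space S] (c : CubeCollapse N S) (G : C(T × (I^N), X)) (g : C(T, X))
    (h : ∀ t, ∀ u ∈ Cube.boundary N, G (t, u) = g t) :
    ∃ F : C(T, C(S, X)), (∀ t u, F t (c.toMap u) = G (t, u)) ∧ ∀ t, F t c.pt = g t := by
  classical
  choose r hr using c.exists_map_eq
  let F : T × S → X := fun z ↦ if hz : z.2 = c.pt then g z.1 else G (z.1, r z.2 hz)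
  have hF1 (t : T) (u : I^N) : F (t, c.toMap u) = G (t, u) := by
    by_cases hu : u ∈ Cube.boundary N
    · simp [F, (c.map_eq_pt_iff u).2 hu, h t u hu]
    · have hu' : c.toMap u ≠ c.pt := fun h ↦ hu ((c.map_eq_pt_iff u).1 h)
      simp only [F, hu', dite_false]
      rw [← c.injOn_interior u _ hu (hr _ hu').symm]
  have hF2 (t : T) : F (t, c.pt) = g t := by simp [F]
  have hF : Continuous F := by
    rw [continuous_iff_isClosed]
    intro C hC
    have h1 : IsClosed (image (Prod.map id c.toMap) (preimage G C) : Set (T × S)) :=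
      (isProperMap_id.prodMap c.toMap.continuous.isProperMap).isClosedMap _
        (hC.preimage G.continuous)
    have h2 : IsClosed {z : T × S | g z.1 ∈ C ∧ z.2 = c.pt} :=
      (hC.preimage (g.continuous.comp continuous_fst)).inter
        (isClosed_eq continuous_snd continuous_const)
    convert h1.union h2 using 1
    ext ⟨t, y⟩
    simp only [mem_preimage, mem_union, mem_image, Prod.exists, Prod.map_apply, id_eq,
      Prod.mk.injEq, mem_ofPred_eq]
    constructor
    · intro hz
      by_cases hy : y = c.pt
      · subst hy
        exact Or.inr ⟨hF2 t ▸ hz, rfl⟩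
      · exact Or.inl ⟨t, r y hy, by rwa [← hF1, hr], rfl, hr y hy⟩
    · rintro (⟨t, u, hu, rfl, rfl⟩ | ⟨ht, rfl⟩)
      · rwa [hF1]
      · rwa [hF2]
  exact ⟨ContinuousMap.curry ⟨F, hF⟩, hF1, hF2⟩

theorem hom_ext (c : CubeCollapse N S) {f g : C(S, X)} (h : ∀ u, f (c.toMap u) = g (c.toMap u))
    (hpt : f c.pt = g c.pt) : f = g := by
  ext y
  by_cases hy : y = c.pt
  · rw [hy, hpt]
  · obtain ⟨u, rfl⟩ := c.exists_map_eq y hy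
    exact h u

/-- The homotopy lifting property of the evaluation fibration `C(S, X) → X`, with lifts that are
constant wherever the data are constant. -/
theorem exists_lift [Fintype N] [T2Space S] [LocallyCompactSpace S] (c : CubeCollapse N S)
    (f : C(T, C(S, X))) (a : C(I × T, X)) (h0 : ∀ t, a (0, t) = f t c.pt) :
    ∃ L : C(I × T, C(S, X)), (∀ t, L (0, t) = f t) ∧ (∀ z, L z c.pt = a z) ∧
      ∀ (x : X) (t : T), f t = ContinuousMap.const S x → (∀ s, a (s, t) = x) →
        ∀ s, L (s, t) = ContinuousMap.const S x := by
  let ρ : (I × T) × (I^N) → ℝ := fun z ↦ (1 + z.1.1) * ‖fun i ↦ 2 * (z.2 i : ℝ) - 1‖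
  have hρ : Continuous ρ := by fun_prop
  let d : (I × T) × (I^N) → I^N := fun z i ↦
    projIcc 0 1 zero_le_one (((1 + z.1.1) * (2 * (z.2 i : ℝ) - 1) + 1) / 2)
  have hd : Continuous d := by fun_prop
  have hd_bdry (z) (hz : ρ z = 1) : d z ∈ Cube.boundary N := by
    refine Cube.mem_boundary_iff.2 (hz.symm.trans ?_).le
    have hs : 0 ≤ (1 + z.1.1 : ℝ) := by linarith [z.1.1.2.1]
    have hv : ρ z = ‖(1 + z.1.1 : ℝ) • fun i ↦ 2 * (z.2 i : ℝ) - 1‖ := by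
      rw [norm_smul, Real.norm_of_nonneg hs]
    rw [hv]
    congr 1
    ext i
    have hi := (norm_le_pi_norm ((1 + z.1.1 : ℝ) • fun i ↦ 2 * (z.2 i : ℝ) - 1) i).trans
      (hv.symm.trans hz).le
    rw [Real.norm_eq_abs, abs_le, Pi.smul_apply, smul_eq_mul] at hi
    have : (((1 + z.1.1) * (2 * (z.2 i : ℝ) - 1) + 1) / 2) ∈ Icc (0 : ℝ) 1 := by
      constructor <;> linarith
    simp only [d, projIcc_of_mem zero_le_one this, Pi.smul_apply, smul_eq_mul]
    ring
  let G : C((I × T) × (I^N), X) := ⟨fun z ↦ if ρ z ≤ 1 then f z.1.2 (c.toMap (d z))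
      else a (projIcc 0 1 zero_le_one (ρ z - 1), z.1.2), by
    refine Continuous.if_le ?_ ?_ hρ continuous_const fun z hz ↦ ?_
    · exact (f.continuous.comp (by fun_prop)).eval (c.toMap.continuous.comp hd)
    · exact a.continuous.comp
        ((continuous_projIcc.comp (hρ.sub continuous_const)).prodMk (by fun_prop))
    · rw [(c.map_eq_pt_iff _).2 (hd_bdry z hz), hz, sub_self, projIcc_left, ← h0]
      rfl⟩
  have hd0 (t : T) (u : I^N) : d ((0, t), u) = u := by
    ext i
    simp [d]
  have hG (z : I × T) (u : I^N) (hu : u ∈ Cube.boundary N) : G (z, u) = a z := by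
    obtain ⟨s, t⟩ := z
    have hn : ‖fun i ↦ 2 * (u i : ℝ) - 1‖ = 1 :=
      le_antisymm (Cube.norm_le_one u) (Cube.mem_boundary_iff.1 hu)
    have hρs : ρ ((s, t), u) = 1 + s := by simp [ρ, hn]
    change (if ρ ((s, t), u) ≤ 1 then _ else _) = _
    rw [hρs]
    split_ifs with h
    · have hs : s = 0 := le_antisymm (by rw [← Subtype.coe_le_coe]; simpa using h) s.2.1
      subst hs
      simp only
      rw [hd0, (c.map_eq_pt_iff u).2 hu, h0]
    · simp
  obtain ⟨L, hL, hLpt⟩ := c.exists_descend G a hG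
  refine ⟨L, fun t ↦ c.hom_ext (fun u ↦ ?_) ?_, hLpt, fun x t hf ha s ↦ c.hom_ext (fun u ↦ ?_) ?_⟩
  · have hle : ρ ((0, t), u) ≤ 1 := by simpa [ρ] using Cube.norm_le_one u
    rw [hL]
    change (if ρ ((0, t), u) ≤ 1 then _ else _) = _
    rw [if_pos hle, hd0]
  · rw [hLpt, h0]
  · rw [hL]
    change (if ρ ((s, t), u) ≤ 1 then _ else _) = _
    simp [hf, ha]
  · rw [hLpt, ha]
    rfl

/-- Generalized loops are the maps out of the collapsed cube which are based at `pt`. -/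
theorem nonempty_genLoop_homeomorph [Finite N] [T2Space S] [LocallyCompactSpace S]
    (c : CubeCollapse N S) (x : X) :
    ∃ e : Ω^ N X x ≃ₜ {f : C(S, X) // f c.pt = x},
      e GenLoop.const = ⟨ContinuousMap.const S x, rfl⟩ := by
  obtain ⟨F, hF, hFpt⟩ := c.exists_descend (T := Ω^ N X x) ⟨fun z ↦ z.1 z.2, by fun_prop⟩
    (ContinuousMap.const _ x) fun p u hu ↦ p.2 u hu
  refine ⟨⟨⟨fun p ↦ ⟨F p, hFpt p⟩, fun f ↦ ⟨f.1.comp c.toMap, fun u hu ↦ ?_⟩, fun p ↦ ?_,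
    fun f ↦ ?_⟩, F.continuous.subtype_mk _, ?_⟩, ?_⟩
  · exact (congrArg f.1 ((c.map_eq_pt_iff u).2 hu)).trans f.2
  · exact GenLoop.ext _ _ (hF p)
  · exact Subtype.ext (c.hom_ext (hF _) ((hFpt _).trans f.2.symm))
  · exact ((ContinuousMap.continuous_precomp _).comp continuous_subtype_val).subtype_mk _
  · exact Subtype.ext (c.hom_ext (hF _) (hFpt _))

end CubeCollapse

end Collapse

/-- For a space `X` with basepoint `x`, and `k = m + 1 ≥ 1`, `n ≥ 0`, the homotopy group
`π_k` of the space `C(Sⁿ, X)` of unbased maps (with the compact-open topology), based at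
the constant map at `x`, is isomorphic to a semidirect product
`π_{n+k}(X, x) ⋊ π_k(X, x)`. -/
theorem homotopyGroup_mappingSpace_sphere_iso_semidirectProduct
    {X : Type*} [TopologicalSpace X] (x : X) (n m : ℕ) :
    ∃ φ : HomotopyGroup (Fin (m + 1)) X x →* MulAut (HomotopyGroup (Fin (n + m + 1)) X x),
      Nonempty
        (HomotopyGroup (Fin (m + 1))
            C(↥(Metric.sphere (0 : EuclideanSpace ℝ (Fin (n + 1))) 1), X)
            (ContinuousMap.const _ x) ≃*
          (HomotopyGroup (Fin (n + m + 1)) X x ⋊[φ] HomotopyGroup (Fin (m + 1)) X x)) := by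
  obtain ⟨c⟩ := nonempty_cubeCollapse_sphere n
  let ev : C(C(↥(Metric.sphere (0 : EuclideanSpace ℝ (Fin (n + 1))) 1), X), X) :=
    ⟨fun f ↦ f c.pt, by fun_prop⟩
  have hlift : HasPointedLifting ev (ContinuousMap.const _ x) x := fun T _ f a h0 ↦ by
    obtain ⟨L, hL0, hL, hLc⟩ := c.exists_lift f a h0
    exact ⟨L, hL0, hL, hLc x⟩
  obtain ⟨e, he⟩ := c.nonempty_genLoop_homeomorph x
  let ι : Fin (n + m + 1) ≃ Fin (m + 1) ⊕ Fin n :=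
    (finCongr (by omega)).trans finSumFinEquiv.symm
  let fibreEquiv : HomotopyGroup (Fin (m + 1)) (GenLoop (Fin n) X x) GenLoop.const ≃*
      HomotopyGroup (Fin (m + 1)) {f // ev f = x} ⟨ContinuousMap.const _ x, rfl⟩ :=
    HomotopyGroup.congr e he
  exact hlift.exists_mulEquiv_semidirectProduct rfl ContinuousMap.const' rfl (fun _ ↦ rfl)
    (((HomotopyGroup.reindex ι).trans HomotopyGroup.iteratedLoop.symm).trans fibreEquiv)
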